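/- Let T be a regular s-interval exchange transformation on [ℓ,r) and let I = [u,v) be an admissible semi-interval for T. Then the first return map S of T on I is a regular s-interval exchange transformation whose separation points are exactly Div(I,T) ∩ I. -/

import Mathlib

open Set

/-- An interval exchange transformation on `[l, r)` exchanging `s` half-open
intervals with boundaries `γ 0 = l < γ 1 < … < γ s = r`, translation values `α`,
and permutation `π` (ordering of the image intervals). -/
structure IET (s : ℕ) where
  l : ℝ
  r : ℝ
  hlr : l < r
  γ : Fin (s + 1) → ℝ
  γ_mono : StrictMono γ
  γ_first : γ 0 = l
  γ_last : γ (Fin.last s) = r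
  α : Fin s → ℝ
  π : Equiv.Perm (Fin s)
  T : ℝ → ℝ
  Tinv : ℝ → ℝ
  hT : ∀ i : Fin s, ∀ x ∈ Ico (γ i.castSucc) (γ i.succ), T x = x + α i
  hmaps : MapsTo T (Ico l r) (Ico l r)
  hinv_left : ∀ x ∈ Ico l r, Tinv (T x) = x
  hinv_right : ∀ x ∈ Ico l r, T (Tinv x) = x
  hinvmaps : MapsTo Tinv (Ico l r) (Ico l r)
  himg_mono : StrictMono fun k : Fin s => γ (Fin.castSucc (π.symm k)) + α (π.symm k)

namespace IET

variable {s : ℕ} (X : IET s)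

/-- The `i`-th exchanged interval `I_i`. -/
def I (i : Fin s) : Set ℝ := Ico (X.γ i.castSucc) (X.γ i.succ)

/-- The separation points `γ_1, …, γ_s` (left boundaries of the `I_i`). -/
def sep (i : Fin s) : ℝ := X.γ i.castSucc

/-- `δ i` : left boundary of the image interval `J_i = T(I_i)`. -/
def δ (i : Fin s) : ℝ := X.γ i.castSucc + X.α i

/-- `ℤ`-iterate of the transformation. -/
def iter (n : ℤ) : ℝ → ℝ := if 0 ≤ n then (X.T)^[n.toNat] else (X.Tinv)^[(-n).toNat]

/-- The two-sided orbit of a point. -/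
def orbit (z : ℝ) : Set ℝ := {y | ∃ n : ℤ, X.iter n z = y}

/-- Minimality: every orbit is dense in `[l, r)`. -/
def Minimal : Prop :=
  ∀ z ∈ Ico X.l X.r, ∀ y ∈ Ico X.l X.r, ∀ ε : ℝ, 0 < ε → ∃ w ∈ X.orbit z, |w - y| < ε

/-- Regularity (Keane's idoc condition): the orbits of the nonzero separation
points are infinite and pairwise disjoint. -/
def Regular : Prop :=
  ∀ i j : Fin s, (i : ℕ) ≠ 0 → (j : ℕ) ≠ 0 → ∀ m n : ℤ,
    X.iter m (X.sep i) = X.iter n (X.sep j) → i = j ∧ m = n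

/-- `I_w` : the set of points whose natural coding begins with the word `w`. -/
def Iw (X : IET s) : List (Fin s) → Set ℝ
  | [] => Ico X.l X.r
  | b :: w => X.I b ∩ X.T ⁻¹' (Iw X w)

/-- `J_w = T^{|w|}(I_w)`. -/
def Jw (w : List (Fin s)) : Set ℝ := (X.T)^[w.length] '' X.Iw w

/-- The factor set `F(T)` of the natural codings of `T`. -/
def Fact : Set (List (Fin s)) := {w | (X.Iw w).Nonempty}

/-- First (positive) return time of `z` to the set `J`. -/
noncomputable def retTime (J : Set ℝ) (z : ℝ) : ℕ := sInf {n : ℕ | 0 < n ∧ (X.T)^[n] z ∈ J}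

/-- First return map of `T` on the set `J`. -/
noncomputable def firstReturn (J : Set ℝ) (z : ℝ) : ℝ := (X.T)^[X.retTime J z] z

/-- `ρ⁺_{[u,v),T}(z) = min {n > 0 | T^n z ∈ (u,v)}`. -/
noncomputable def rhoP (u v z : ℝ) : ℕ := sInf {n : ℕ | 0 < n ∧ X.iter n z ∈ Ioo u v}

/-- `ρ⁻_{[u,v),T}(z) = min {n ≥ 0 | T^{-n} z ∈ (u,v)}`. -/
noncomputable def rhoM (u v z : ℝ) : ℕ := sInf {n : ℕ | X.iter (-(n : ℤ)) z ∈ Ioo u v}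

/-- The set of neighbors of `z` with respect to `[u,v)` and `T`. -/
def nbrs (u v z : ℝ) : Set ℝ :=
  {y | ∃ k : ℤ, -(X.rhoM u v z : ℤ) ≤ k ∧ k < (X.rhoP u v z : ℤ) ∧ X.iter k z = y}

/-- The set of division points of `[u,v)` with respect to `T`. -/
def Div (u v : ℝ) : Set ℝ := ⋃ i : Fin s, X.nbrs u v (X.sep i)

/-- A semi-interval `[u,v) ⊆ [l,r)` is admissible for `T` if both of its
endpoints belong to `Div([u,v),T) ∪ {r}`. -/
def Admissible (u v : ℝ) : Prop :=
  X.l ≤ u ∧ u < v ∧ v ≤ X.r ∧ u ∈ X.Div u v ∧ (v ∈ X.Div u v ∨ v = X.r)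

/-- `Y` is (a presentation of) the transformation induced by `X` on `[u,v)`:
its domain is `[u,v)`, it acts as the first return map of `X`, and its
separation points are the division points of `[u,v)` inside `[u,v)`. -/
def InducedOn (Y : IET s) (u v : ℝ) : Prop :=
  Y.l = u ∧ Y.r = v ∧ (∀ z ∈ Ico u v, Y.T z = X.firstReturn (Ico u v) z) ∧
    {y | ∃ i : Fin s, Y.sep i = y} = X.Div u v ∩ Ico u v

end IET
open Set

namespace IET

section aux
variable {s : ℕ} (X : IET s)

open Classical in
/-- The transformation extended by the identity to a permutation of the line. -/
noncomputable def E : Equiv.Perm ℝ where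
  toFun x := if x ∈ Ico X.l X.r then X.T x else x
  invFun x := if x ∈ Ico X.l X.r then X.Tinv x else x
  left_inv x := by
    by_cases h : x ∈ Ico X.l X.r
    · simp only [if_pos h, if_pos (X.hmaps h)]
      exact X.hinv_left x h
    · simp only [if_neg h]
  right_inv x := by
    by_cases h : x ∈ Ico X.l X.r
    · simp only [if_pos h, if_pos (X.hinvmaps h)]
      exact X.hinv_right x h
    · simp only [if_neg h]

/-- Integer iterates of the extended transformation. -/
noncomputable def P (n : ℤ) (z : ℝ) : ℝ := (X.E ^ n) z

lemma P_add (a b : ℤ) (z : ℝ) : X.P (a + b) z = X.P a (X.P b z) := by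
  unfold P; rw [zpow_add]; rfl

lemma P_zero (z : ℝ) : X.P 0 z = z := by simp [P]

lemma P_one (z : ℝ) (h : z ∈ Ico X.l X.r) : X.P 1 z = X.T z := by
  have : X.P 1 z = if z ∈ Ico X.l X.r then X.T z else z := by unfold P; rw [zpow_one]; rfl
  rw [this, if_pos h]

lemma P_neg_one (z : ℝ) (h : z ∈ Ico X.l X.r) : X.P (-1) z = X.Tinv z := by
  have : X.P (-1) z = if z ∈ Ico X.l X.r then X.Tinv z else z := by
    unfold P; rw [zpow_neg_one]; rfl
  rw [this, if_pos h]

lemma P_inj (n : ℤ) {x y : ℝ} (h : X.P n x = X.P n y) : x = y := (X.E ^ n).injective h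

lemma P_mem (n : ℤ) (z : ℝ) (h : z ∈ Ico X.l X.r) : X.P n z ∈ Ico X.l X.r := by
  have hp : ∀ n : ℕ, X.P n z ∈ Ico X.l X.r := by
    intro n
    induction n with
    | zero => simpa [P_zero] using h
    | succ n ih =>
      have : ((n + 1 : ℕ) : ℤ) = 1 + n := by push_cast; ring
      rw [this, P_add, P_one _ _ ih]
      exact X.hmaps ih
  have hm : ∀ n : ℕ, X.P (-(n : ℤ)) z ∈ Ico X.l X.r := by
    intro n
    induction n with
    | zero => simpa [P_zero] using h
    | succ n ih =>
      have : (-((n + 1 : ℕ) : ℤ)) = -1 + -n := by push_cast; ring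
      rw [this, P_add, P_neg_one _ _ ih]
      exact X.hinvmaps ih
  obtain ⟨k, rfl | rfl⟩ := n.eq_nat_or_neg
  · exact hp k
  · exact hm k

lemma iterT (n : ℕ) (z : ℝ) (h : z ∈ Ico X.l X.r) : X.T^[n] z = X.P n z := by
  induction n with
  | zero => simp [P_zero]
  | succ n ih =>
    have : ((n + 1 : ℕ) : ℤ) = 1 + n := by push_cast; ring
    rw [Function.iterate_succ_apply', ih, this, P_add, P_one _ _ (X.P_mem _ _ h)]

lemma iterTinv (n : ℕ) (z : ℝ) (h : z ∈ Ico X.l X.r) : X.Tinv^[n] z = X.P (-(n : ℤ)) z := by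
  induction n with
  | zero => simp [P_zero]
  | succ n ih =>
    have : (-((n + 1 : ℕ) : ℤ)) = -1 + -n := by push_cast; ring
    rw [Function.iterate_succ_apply', ih, this, P_add, P_neg_one _ _ (X.P_mem _ _ h)]

lemma iter_eq (n : ℤ) (z : ℝ) (h : z ∈ Ico X.l X.r) : X.iter n z = X.P n z := by
  unfold iter
  split_ifs with hn
  · rw [X.iterT _ _ h, Int.toNat_of_nonneg hn]
  · rw [X.iterTinv _ _ h, Int.toNat_of_nonneg (by omega), neg_neg]

lemma P_neg_cancel (n : ℤ) (z : ℝ) : X.P (-n) (X.P n z) = z := by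
  rw [← P_add]; simp [P_zero]

lemma P_cancel_neg (n : ℤ) (z : ℝ) : X.P n (X.P (-n) z) = z := by
  rw [← P_add]; simp [P_zero]

end aux

lemma cover {n : ℕ} (c : Fin (n + 1) → ℝ) (x : ℝ)
    (h : x ∈ Ico (c 0) (c (Fin.last n))) : ∃ i : Fin n, x ∈ Ico (c i.castSucc) (c i.succ) := by
  by_contra hcon
  push Not at hcon
  have : ∀ i : Fin (n + 1), c i ≤ x := by
    intro i
    induction i using Fin.induction with
    | zero => exact h.1
    | succ i ih =>
      by_contra hlt
      exact hcon i ⟨ih, not_le.mp hlt⟩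
  exact absurd h.2 (not_lt.mpr (this _))

section aux2
variable {s : ℕ} (X : IET s)

lemma s_pos {s : ℕ} (X : IET s) : 0 < s := by
  rcases Nat.eq_zero_or_pos s with h | h
  · subst h
    have h1 := X.γ_first
    have h2 := X.γ_last
    have h3 := X.hlr
    have : Fin.last 0 = 0 := rfl
    rw [this] at h2
    linarith
  · exact h

lemma γ_le (i : Fin (s+1)) : X.l ≤ X.γ i ∧ X.γ i ≤ X.r := by
  rw [← X.γ_first, ← X.γ_last]
  exact ⟨X.γ_mono.monotone (Fin.zero_le _), X.γ_mono.monotone (Fin.le_last _)⟩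

lemma sep_lt_succ (i : Fin s) : X.sep i < X.γ i.succ := X.γ_mono (Fin.castSucc_lt_succ)

lemma sep_mem (i : Fin s) : X.sep i ∈ Ico X.l X.r :=
  ⟨(X.γ_le _).1, lt_of_lt_of_le (X.sep_lt_succ i) (X.γ_le _).2⟩

lemma sep_zero (i : Fin s) (h : (i : ℕ) = 0) : X.sep i = X.l := by
  rw [← X.γ_first]
  unfold sep
  congr 1
  ext; simpa using h

lemma sep_pos (i : Fin s) (h : (i : ℕ) ≠ 0) : X.l < X.sep i := by
  rw [← X.γ_first]
  apply X.γ_mono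
  rw [Fin.lt_def]; simp; omega

lemma pieceX (x : ℝ) (h : x ∈ Ico X.l X.r) : ∃ i : Fin s, x ∈ Ico (X.sep i) (X.γ i.succ) := by
  rw [← X.γ_first, ← X.γ_last] at h
  exact cover X.γ x h

lemma P_one_piece (i : Fin s) (x : ℝ) (h : x ∈ Ico (X.sep i) (X.γ i.succ)) :
    X.P 1 x = x + X.α i := by
  rw [P_one, X.hT i x h]
  exact ⟨le_trans (X.sep_mem i).1 h.1, lt_of_lt_of_le h.2 (X.γ_le _).2⟩

/-- a point of `[l,r)` in piece i, whose image is `y`: the left endpoint maps to something `≤ y` -/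
lemma exists_pre (y : ℝ) (hy : y ∈ Ico X.l X.r) : ∃ k : Fin s, ∃ x ∈ Ico (X.sep k) (X.γ k.succ),
    X.P 1 x = y := by
  obtain ⟨k, hk⟩ := X.pieceX _ (X.P_mem (-1) y hy)
  exact ⟨k, _, hk, X.P_cancel_neg 1 y⟩

lemma reg' (hreg : X.Regular) (i j : Fin s) (hi : (i : ℕ) ≠ 0) (hj : (j : ℕ) ≠ 0) (m n : ℤ)
    (h : X.P m (X.sep i) = X.P n (X.sep j)) : i = j ∧ m = n := by
  apply hreg i j hi hj m n
  rwa [X.iter_eq _ _ (X.sep_mem i), X.iter_eq _ _ (X.sep_mem j)]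

lemma pre_l (hreg : X.Regular) (hs : 2 ≤ s) :
    ∃ j : Fin s, (j : ℕ) ≠ 0 ∧ X.P 1 (X.sep j) = X.l := by
  have hl : X.l ∈ Ico X.l X.r := ⟨le_rfl, X.hlr⟩
  obtain ⟨j, x, hx, hxl⟩ := X.exists_pre X.l hl
  have e1 := X.P_one_piece j x hx
  have e2 := X.P_one_piece j (X.sep j) ⟨le_rfl, X.sep_lt_succ j⟩
  have e3 := (X.P_mem 1 _ (X.sep_mem j)).1
  have hj : X.P 1 (X.sep j) = X.l := by linarith [hx.1]
  refine ⟨j, ?_, hj⟩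
  intro hj0
  have hα : X.α j = 0 := by rw [e2, X.sep_zero j hj0] at hj; linarith
  -- piece 0 is fixed
  let i1 : Fin s := ⟨1, by omega⟩
  have hi1 : X.sep i1 = X.γ j.succ := by
    unfold sep; congr 1; ext; simp [i1, hj0]
  have hfix : ∀ x, X.l ≤ x → x < X.sep i1 → X.P 1 x = x := by
    intro x h1 h2
    rw [X.P_one_piece j x ⟨by rw [X.sep_zero j hj0]; exact h1, by rw [← hi1]; exact h2⟩, hα, add_zero]
  obtain ⟨k, y, hy, hyl⟩ := X.exists_pre (X.sep i1) (X.sep_mem i1)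
  have f1 := X.P_one_piece k y hy
  have f2 := X.P_one_piece k (X.sep k) ⟨le_rfl, X.sep_lt_succ k⟩
  have f3 := (X.P_mem 1 _ (X.sep_mem k)).1
  have hk : (k : ℕ) ≠ 0 := by
    intro hk0
    have : k = j := Fin.ext (by omega)
    subst this
    rw [hα] at f1
    have := hy.2
    rw [← hi1] at this
    linarith
  have hk1 : X.sep i1 ≤ X.sep k := by
    unfold sep
    apply X.γ_mono.monotone
    rw [Fin.le_def]; simp [i1]; omega
  have : X.P 1 (X.sep k) = X.P 0 (X.sep i1) := by
    rw [P_zero]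
    by_contra hne
    have hlt : X.P 1 (X.sep k) < X.sep i1 := lt_of_le_of_ne (by linarith [hy.1]) hne
    have := X.P_inj 1 (hfix _ f3 hlt)
    linarith
  have := (X.reg' hreg k i1 hk (by simp [i1]) _ _ this).2
  omega

/-- every separation point is on the orbit of a nonzero one -/
lemma sep_orb (hreg : X.Regular) (hs : 2 ≤ s) (i : Fin s) :
    ∃ j : Fin s, (j : ℕ) ≠ 0 ∧ ((i = j ∧ X.sep i = X.P 0 (X.sep j)) ∨
      ((i : ℕ) = 0 ∧ X.sep i = X.P 1 (X.sep j))) := by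
  by_cases h : (i : ℕ) = 0
  · obtain ⟨j, hj, hl⟩ := X.pre_l hreg hs
    exact ⟨j, hj, Or.inr ⟨h, by rw [hl, X.sep_zero i h]⟩⟩
  · exact ⟨i, h, Or.inl ⟨rfl, by rw [P_zero]⟩⟩

lemma sep_not_per (hreg : X.Regular) (hs : 2 ≤ s) (i : Fin s) (p : ℤ)
    (h : X.P p (X.sep i) = X.sep i) : p = 0 := by
  obtain ⟨j, hj, ⟨_, e⟩ | ⟨_, e⟩⟩ := X.sep_orb hreg hs i
  · rw [e, ← P_add] at h
    have := (X.reg' hreg j j hj hj _ _ h).2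
    omega
  · rw [e, ← P_add] at h
    have := (X.reg' hreg j j hj hj _ _ h).2
    omega

lemma noPer (hreg : X.Regular) (hs : 2 ≤ s) (z : ℝ) (hz : z ∈ Ico X.l X.r) (p : ℕ) (hp : 0 < p) :
    X.P p z ≠ z := by
  intro hper
  have hidx : ∀ k : ℕ, ∃ i : Fin s, X.P k z ∈ Ico (X.sep i) (X.γ i.succ) :=
    fun k => X.pieceX _ (X.P_mem _ _ hz)
  choose g hg using hidx
  obtain ⟨k0, hk0, hmin⟩ := Finset.exists_min_image (Finset.range p)
    (fun k => X.P k z - X.sep (g k)) ⟨0, by simpa using hp⟩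
  set t := X.P k0 z - X.sep (g k0) with ht
  have ht0 : 0 ≤ t := by linarith [(hg k0).1]
  have key : ∀ k : ℕ, k ≤ p → X.P k (z - t) = X.P k z - t := by
    intro k
    induction k with
    | zero => intro _; simp [P_zero]
    | succ k ih =>
      intro hk
      have hm := hmin k (by simp; omega)
      have : ((k + 1 : ℕ) : ℤ) = 1 + k := by push_cast; ring
      rw [this, P_add, P_add, ih (by omega), X.P_one_piece (g k) _ (hg k),
        X.P_one_piece (g k) (X.P k z - t) ⟨by linarith, by linarith [(hg k).2]⟩]
      ring
  have h1 := key p le_rfl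
  rw [hper] at h1
  have h2 := key k0 (by simp at hk0; omega)
  have h3 : X.P k0 (z - t) = X.sep (g k0) := by rw [h2, ht]; ring
  have h4 : X.P p (X.sep (g k0)) = X.sep (g k0) := by
    rw [← h3, ← P_add, add_comm, P_add, h1]
  have := X.sep_not_per hreg hs _ _ h4
  omega

end aux2

end IET

namespace IET

section ret
variable {s : ℕ} (X : IET s)

/-- The interval from d is translated up to its simultaneous first return time `m` to `[u,v)`. -/
def Ret (u v d d' : ℝ) (m : ℕ) : Prop :=
  0 < m ∧ (∀ k : ℕ, k ≤ m → ∃ τ, ∀ x ∈ Ico d d', X.P k x = x + τ) ∧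
  (∀ k : ℕ, 0 < k → k < m → ∀ x ∈ Ico d d', X.P k x ∉ Ico u v) ∧
  ∀ x ∈ Ico d d', X.P m x ∈ Ico u v

/-- the special points governing the first return to `[u,v)` -/
def Sp (u v w : ℝ) : Prop :=
  (∃ i : Fin s, (i : ℕ) ≠ 0 ∧ w = X.sep i) ∨ (w = u ∧ X.l < u) ∨ (w = v ∧ v < X.r)

/-- no interior separation points: contained in one piece -/
lemma one_piece (a b : ℝ) (hab : a < b) (ha : X.l ≤ a) (hb : b ≤ X.r)
    (h : ∀ i : Fin s, (i : ℕ) ≠ 0 → X.sep i ∉ Ioo a b) :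
    ∃ i : Fin s, X.sep i ≤ a ∧ b ≤ X.γ i.succ := by
  obtain ⟨i, hi⟩ := X.pieceX a ⟨ha, lt_of_lt_of_le hab hb⟩
  refine ⟨i, hi.1, ?_⟩
  by_contra hlt
  push Not at hlt
  have hi2 : (i : ℕ) + 1 < s := by
    by_contra hge
    have : i.succ = Fin.last s := by ext; simp; omega
    rw [this, X.γ_last] at hlt
    linarith
  apply h ⟨i + 1, hi2⟩ (by simp)
  have : X.sep ⟨i + 1, hi2⟩ = X.γ i.succ := by unfold sep; congr 1
  rw [this]
  exact ⟨hi.2, hlt⟩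

lemma ret_exists (u v d d' : ℝ) (hlu : X.l ≤ u) (hvr : v ≤ X.r) (hdd : d < d')
    (hud : u ≤ d) (hdv : d' ≤ v)
    (hP : ∀ w, X.Sp u v w → ∀ k : ℕ, X.P (-(k : ℤ)) w ∈ Ioo u v →
      (∀ j : ℕ, j < k → X.P (-(j : ℤ)) w ∉ Ioo u v) → X.P (-(k : ℤ)) w ∉ Ioo d d') :
    ∃ m, X.Ret u v d d' m := by
  have hA : ∀ x ∈ Ico d d', x ∈ Ico X.l X.r := fun x hx =>
    ⟨by linarith [hx.1], by linarith [hx.2]⟩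
  have hI : ∀ x ∈ Ico d d', x ∈ Ico u v := fun x hx =>
    ⟨by linarith [hx.1], by linarith [hx.2]⟩
  -- if the first k images avoid I, special points are not inside the image
  have hsp : ∀ k : ℕ, ∀ τ, (∀ x ∈ Ico d d', X.P k x = x + τ) →
      (∀ j : ℕ, 0 < j → j < k → ∀ x ∈ Ico d d', X.P j x ∉ Ico u v) →
      ∀ w, X.Sp u v w → (0 < k → w ∉ Ioo u v) → w ∉ Ioo (d + τ) (d' + τ) := by
    intro k τ hτ hav w hw hwI hmem
    have hx : w - τ ∈ Ioo d d' := ⟨by linarith [hmem.1], by linarith [hmem.2]⟩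
    have e : X.P (-(k : ℤ)) w = w - τ := by
      have := hτ (w - τ) ⟨hx.1.le, hx.2⟩
      have h2 : X.P k (w - τ) = w := by linarith
      rw [← h2, P_neg_cancel, h2]
    refine hP w hw k ?_ ?_ (by rw [e]; exact hx)
    · rw [e]; exact ⟨by linarith [hx.1], by linarith [hx.2]⟩
    · intro j hj hjm
      rcases Nat.eq_zero_or_pos j with rfl | hj0
      · simp only [Nat.cast_zero, neg_zero, P_zero] at hjm
        exact hwI hj hjm
      · have : X.P (-(j : ℤ)) w = X.P ((k - j : ℕ) : ℤ) (w - τ) := by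
          rw [← e, ← P_add]
          congr 1
          push_cast [Nat.cast_sub hj.le]; ring
        rw [this] at hjm
        exact hav (k - j) (by omega) (by omega) (w - τ) ⟨hx.1.le, hx.2⟩ ⟨hjm.1.le, hjm.2⟩
  have htr : ∀ k : ℕ, (∀ j : ℕ, 0 < j → j < k → ∀ x ∈ Ico d d', X.P j x ∉ Ico u v) →
      ∃ τ, ∀ x ∈ Ico d d', X.P k x = x + τ := by
    intro k
    induction k with
    | zero => intro _; exact ⟨0, fun x _ => by simp [P_zero]⟩
    | succ k ih =>
      intro hav
      obtain ⟨τ, hτ⟩ := ih (fun j h1 h2 => hav j h1 (by omega))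
      have hns : ∀ i : Fin s, (i : ℕ) ≠ 0 → X.sep i ∉ Ioo (d + τ) (d' + τ) := by
        intro i hi hmem
        refine hsp k τ hτ (fun j h1 h2 => hav j h1 (by omega)) (X.sep i) (Or.inl ⟨i, hi, rfl⟩)
          ?_ hmem
        intro hk hI'
        have := hav k hk (by omega) (X.sep i - τ) ⟨by linarith [hmem.1], by linarith [hmem.2]⟩
        rw [hτ _ ⟨by linarith [hmem.1], by linarith [hmem.2]⟩] at this
        apply this
        rw [sub_add_cancel]
        exact ⟨hI'.1.le, hI'.2⟩
      have h1 : X.l ≤ d + τ := by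
        rw [← hτ d ⟨le_rfl, hdd⟩]
        exact (X.P_mem _ _ (hA d ⟨le_rfl, hdd⟩)).1
      have h2 : d' + τ ≤ X.r := by
        by_contra hlt
        push Not at hlt
        have hm : max d (X.r - τ) ∈ Ico d d' := ⟨le_max_left _ _, max_lt hdd (by linarith)⟩
        have h3 := (X.P_mem k _ (hA _ hm)).2
        rw [hτ _ hm] at h3
        linarith [le_max_right d (X.r - τ)]
      obtain ⟨i, hi1, hi2⟩ := X.one_piece (d + τ) (d' + τ) (by linarith) h1 h2 hns
      refine ⟨τ + X.α i, fun x hx => ?_⟩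
      have : ((k + 1 : ℕ) : ℤ) = 1 + k := by push_cast; ring
      rw [this, P_add, hτ x hx, X.P_one_piece i _ ⟨by linarith [hx.1], by linarith [hx.2]⟩]
      ring
  have hex : ∃ k : ℕ, 0 < k ∧ ∃ x ∈ Ico d d', X.P k x ∈ Ico u v := by
    by_contra hcon
    push Not at hcon
    have hav : ∀ j : ℕ, 0 < j → ∀ x ∈ Ico d d', X.P j x ∉ Ico u v := hcon
    have htr' : ∀ k : ℕ, ∃ τ, ∀ x ∈ Ico d d', X.P k x = x + τ :=
      fun k => htr k (fun j h1 _ => hav j h1)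
    have hdJ : d ∈ Ico d d' := ⟨le_rfl, hdd⟩
    have hne : ∀ j k : ℕ, j ≠ k → X.P j d ≤ X.P k d → X.P k d < X.P j d + (d' - d) → False := by
      intro j k hjk h1 h2
      obtain ⟨τ, hτ⟩ := htr' j
      have e0 := hτ d hdJ
      have hx : d + (X.P k d - X.P j d) ∈ Ico d d' := ⟨by linarith, by linarith⟩
      have e1 : X.P j (d + (X.P k d - X.P j d)) = X.P k d := by
        rw [hτ _ hx]; linarith
      rcases lt_or_gt_of_ne hjk with h | h
      · have : X.P ((k - j : ℕ) : ℤ) d = d + (X.P k d - X.P j d) := by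
          apply X.P_inj j
          rw [e1, ← P_add]; congr 1; push_cast [Nat.cast_sub h.le]; ring
        exact hav (k - j) (by omega) d hdJ (by rw [this]; exact hI _ hx)
      · have : X.P ((j - k : ℕ) : ℤ) (d + (X.P k d - X.P j d)) = d := by
          apply X.P_inj k
          have e2 : (k : ℤ) + ((j - k : ℕ) : ℤ) = j := by push_cast [Nat.cast_sub h.le]; ring
          rw [← P_add, e2, e1]
        exact hav (j - k) (by omega) _ hx (by rw [this]; exact hI _ hdJ)
    have hmaps : ∀ k ∈ (univ : Set ℕ), ⌊(X.P k d - X.l) / (d' - d)⌋ ∈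
        Icc (0 : ℤ) ⌊(X.r - X.l) / (d' - d)⌋ := by
      intro k _
      have := X.P_mem k d (hA d hdJ)
      have hpos : 0 < d' - d := by linarith
      refine ⟨Int.floor_nonneg.mpr (div_nonneg (by linarith [this.1]) hpos.le), ?_⟩
      apply Int.floor_le_floor
      apply div_le_div_of_nonneg_right _ hpos.le
      linarith [this.2]
    obtain ⟨j, _, k, _, hjk, heq⟩ := infinite_univ.exists_ne_map_eq_of_mapsTo hmaps
      (finite_Icc _ _)
    have habs := Int.abs_sub_lt_one_of_floor_eq_floor heq
    have hpos : 0 < d' - d := by linarith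
    rw [← sub_div, abs_div, abs_of_pos hpos, div_lt_one hpos, abs_lt] at habs
    rcases le_total (X.P j d) (X.P k d) with h | h
    · exact hne j k hjk h (by linarith)
    · exact hne k j hjk.symm h (by linarith)
  classical
  let m := Nat.find hex
  obtain ⟨hm0, x0, hx0, hx0I⟩ := Nat.find_spec hex
  have hav : ∀ j : ℕ, 0 < j → j < m → ∀ x ∈ Ico d d', X.P j x ∉ Ico u v := by
    intro j h1 h2 x hx hxI
    exact Nat.find_min hex h2 ⟨h1, x, hx, hxI⟩
  refine ⟨m, hm0, fun k hk => htr k (fun j h1 h2 => hav j h1 (by omega)), hav, ?_⟩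
  obtain ⟨τ, hτ⟩ := htr m hav
  have hx0I' : x0 + τ ∈ Ico u v := by rw [← hτ x0 hx0]; exact hx0I
  intro x hx
  have hxA := X.P_mem m x (hA x hx)
  rw [hτ x hx] at hxA
  rw [hτ x hx]
  have hdA := X.P_mem m d (hA d ⟨le_rfl, hdd⟩)
  rw [hτ d ⟨le_rfl, hdd⟩] at hdA
  constructor
  · by_contra hlt
    push Not at hlt
    exact hsp m τ hτ hav u (Or.inr (Or.inl ⟨rfl, by linarith [hxA.1]⟩))
      (fun _ h => lt_irrefl _ h.1) ⟨by linarith [hx.1], by linarith [hx0I'.1, hx0.2]⟩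
  · by_contra hlt
    push Not at hlt
    exact hsp m τ hτ hav v (Or.inr (Or.inr ⟨rfl, by linarith [hxA.2]⟩))
      (fun _ h => lt_irrefl _ h.2) ⟨by linarith [hx0.1, hx0I'.2], by linarith [hx.2]⟩

/-- the first return data on a whole partition -/
def RetPart (u v : ℝ) {n : ℕ} (c : Fin (n + 1) → ℝ) (m : Fin n → ℕ) : Prop :=
  X.l ≤ u ∧ u < v ∧ v ≤ X.r ∧ StrictMono c ∧ c 0 = u ∧ c (Fin.last n) = v ∧
    ∀ i : Fin n, X.Ret u v (c i.castSucc) (c i.succ) (m i)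

lemma retPart_exists (u v : ℝ) (hlu : X.l ≤ u) (huv : u < v) (hvr : v ≤ X.r) {n : ℕ}
    (c : Fin (n + 1) → ℝ) (hc : StrictMono c) (h0 : c 0 = u) (h1 : c (Fin.last n) = v)
    (hP : ∀ w, X.Sp u v w → ∀ k : ℕ, X.P (-(k : ℤ)) w ∈ Ioo u v →
      (∀ j : ℕ, j < k → X.P (-(j : ℤ)) w ∉ Ioo u v) → X.P (-(k : ℤ)) w ∈ range c) :
    ∃ m, X.RetPart u v c m := by
  have : ∀ i : Fin n, ∃ m, X.Ret u v (c i.castSucc) (c i.succ) m := by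
    intro i
    refine X.ret_exists u v _ _ hlu hvr (hc Fin.castSucc_lt_succ) ?_ ?_ ?_
    · rw [← h0]; exact hc.monotone (Fin.zero_le _)
    · rw [← h1]; exact hc.monotone (Fin.le_last _)
    · intro w hw k hk hj hmem
      obtain ⟨q, hq⟩ := hP w hw k hk hj
      rw [← hq] at hmem
      have a1 := hc.lt_iff_lt.mp hmem.1
      have a2 := hc.lt_iff_lt.mp hmem.2
      rw [Fin.lt_def] at a1 a2
      simp at a1 a2
      omega
  choose m hm using this
  exact ⟨m, hlu, huv, hvr, hc, h0, h1, hm⟩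

variable {X} {u v : ℝ} {n : ℕ} {c : Fin (n + 1) → ℝ} {m : Fin n → ℕ}

lemma RetPart.cov (h : X.RetPart u v c m) {x : ℝ} (hx : x ∈ Ico u v) :
    ∃ i : Fin n, x ∈ Ico (c i.castSucc) (c i.succ) := by
  obtain ⟨_, _, _, _, h0, h1, _⟩ := h
  apply cover
  rwa [h0, h1]

lemma RetPart.sub (h : X.RetPart u v c m) (i : Fin n) {x : ℝ}
    (hx : x ∈ Ico (c i.castSucc) (c i.succ)) : x ∈ Ico u v := by
  obtain ⟨_, _, _, hc, h0, h1, _⟩ := h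
  have a1 : u ≤ c i.castSucc := by rw [← h0]; exact hc.monotone (Fin.zero_le _)
  have a2 : c i.succ ≤ v := by rw [← h1]; exact hc.monotone (Fin.le_last _)
  exact ⟨by linarith [hx.1], by linarith [hx.2]⟩

lemma RetPart.memA (h : X.RetPart u v c m) {x : ℝ} (hx : x ∈ Ico u v) : x ∈ Ico X.l X.r := by
  obtain ⟨h1, _, h3, _⟩ := h
  exact ⟨by linarith [hx.1], by linarith [hx.2]⟩

lemma RetPart.retTime (h : X.RetPart u v c m) (i : Fin n) {x : ℝ}
    (hx : x ∈ Ico (c i.castSucc) (c i.succ)) : X.retTime (Ico u v) x = m i := by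
  have hA := h.memA (h.sub i hx)
  obtain ⟨hm0, htr, hav, hret⟩ := h.2.2.2.2.2.2 i
  unfold IET.retTime
  have hmem : m i ∈ {n : ℕ | 0 < n ∧ X.T^[n] x ∈ Ico u v} :=
    ⟨hm0, by rw [X.iterT _ _ hA]; exact hret x hx⟩
  apply le_antisymm (Nat.sInf_le hmem)
  obtain ⟨h1, h2⟩ := Nat.sInf_mem ⟨_, hmem⟩
  by_contra hlt
  push Not at hlt
  rw [X.iterT _ _ hA] at h2
  exact hav _ h1 hlt x hx h2

lemma RetPart.fr (h : X.RetPart u v c m) (i : Fin n) {x : ℝ}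
    (hx : x ∈ Ico (c i.castSucc) (c i.succ)) : X.firstReturn (Ico u v) x = X.P (m i) x := by
  unfold firstReturn
  rw [h.retTime i hx, X.iterT _ _ (h.memA (h.sub i hx))]

lemma RetPart.maps (h : X.RetPart u v c m) :
    MapsTo (X.firstReturn (Ico u v)) (Ico u v) (Ico u v) := by
  intro x hx
  obtain ⟨i, hi⟩ := h.cov hx
  rw [h.fr i hi]
  exact (h.2.2.2.2.2.2 i).2.2.2 x hi

lemma RetPart.inj (h : X.RetPart u v c m) :
    InjOn (X.firstReturn (Ico u v)) (Ico u v) := by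
  have key : ∀ x y : ℝ, ∀ i j : Fin n, x ∈ Ico (c i.castSucc) (c i.succ) →
      y ∈ Ico (c j.castSucc) (c j.succ) → m i ≤ m j → X.P (m i) x = X.P (m j) y → x = y := by
    intro x y i j hi hj hij hxy
    have e : X.P ((m j - m i : ℕ) : ℤ) y = x := by
      apply X.P_inj (m i)
      rw [hxy, ← P_add]; congr 1; push_cast [Nat.cast_sub hij]; ring
    rcases Nat.eq_zero_or_pos (m j - m i) with h0 | h0
    · rw [h0] at e; rw [← e]; simp [P_zero]
    · exfalso
      refine (h.2.2.2.2.2.2 j).2.2.1 _ h0 ?_ y hj (by rw [e]; exact h.sub i hi)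
      have := (h.2.2.2.2.2.2 i).1
      omega
  intro x hx y hy hxy
  obtain ⟨i, hi⟩ := h.cov hx
  obtain ⟨j, hj⟩ := h.cov hy
  rw [h.fr i hi, h.fr j hj] at hxy
  rcases le_total (m i) (m j) with hle | hle
  · exact key x y i j hi hj hle hxy
  · exact (key y x j i hj hi hle hxy.symm).symm

lemma RetPart.disj (h : X.RetPart u v c m) (i j : Fin n) (x : ℝ)
    (hi : x ∈ Ico (c i.castSucc) (c i.succ)) (hj : x ∈ Ico (c j.castSucc) (c j.succ)) :
    i = j := by
  have hc := h.2.2.2.1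
  have a1 := hc.lt_iff_lt.mp (lt_of_le_of_lt hi.1 hj.2)
  have a2 := hc.lt_iff_lt.mp (lt_of_le_of_lt hj.1 hi.2)
  rw [Fin.lt_def] at a1 a2
  simp at a1 a2
  ext; omega

open MeasureTheory in
lemma RetPart.surj (h : X.RetPart u v c m) :
    SurjOn (X.firstReturn (Ico u v)) (Ico u v) (Ico u v) := by
  set f := X.firstReturn (Ico u v) with hf
  have htr : ∀ i : Fin n, ∃ τ, ∀ x ∈ Ico (c i.castSucc) (c i.succ), f x = x + τ := by
    intro i
    obtain ⟨τ, hτ⟩ := (h.2.2.2.2.2.2 i).2.1 (m i) le_rfl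
    exact ⟨τ, fun x hx => by rw [hf, h.fr i hx, hτ x hx]⟩
  choose τ hτ using htr
  have himg : ∀ i : Fin n, f '' Ico (c i.castSucc) (c i.succ) =
      Ico (c i.castSucc + τ i) (c i.succ + τ i) := by
    intro i
    rw [← image_add_const_Ico]
    exact image_congr (hτ i)
  intro y hy
  by_contra hny
  have hny' : ∀ i : Fin n, y ∉ Ico (c i.castSucc + τ i) (c i.succ + τ i) := by
    intro i hi
    rw [← himg i] at hi
    obtain ⟨x, hx, rfl⟩ := hi
    exact hny ⟨x, h.sub i hx, rfl⟩
  -- choose ε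
  have hε : ∃ b, y < b ∧ b ≤ v ∧ ∀ i : Fin n, ∀ z ∈ Ico y b,
      z ∉ Ico (c i.castSucc + τ i) (c i.succ + τ i) := by
    have : ∀ i : Fin n, ∃ b, y < b ∧ ∀ z ∈ Ico y b,
        z ∉ Ico (c i.castSucc + τ i) (c i.succ + τ i) := by
      intro i
      rcases lt_or_ge y (c i.castSucc + τ i) with hlt | hge
      · exact ⟨_, hlt, fun z hz hz' => absurd hz.2 (not_lt.mpr hz'.1)⟩
      · refine ⟨y + 1, by linarith, fun z hz hz' => hny' i ⟨hge, ?_⟩⟩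
        linarith [hz.1, hz'.2]
    choose b hb1 hb2 using this
    have hfin : ∃ b0, y < b0 ∧ b0 ≤ v ∧ ∀ i, b0 ≤ b i := by
      obtain ⟨b0, hb0, hmin⟩ := Finset.exists_min_image
        (insert v (Finset.univ.image b)) id ⟨v, by simp⟩
      refine ⟨b0, ?_, hmin v (by simp), fun i => hmin (b i) (by simp)⟩
      simp only [Finset.mem_insert, Finset.mem_image, Finset.mem_univ, true_and] at hb0
      rcases hb0 with rfl | ⟨i, rfl⟩
      · exact hy.2
      · exact hb1 i
    obtain ⟨b0, h1, h2, h3⟩ := hfin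
    exact ⟨b0, h1, h2, fun i z hz => hb2 i z ⟨hz.1, lt_of_lt_of_le hz.2 (h3 i)⟩⟩
  obtain ⟨b, hyb, hbv, hb⟩ := hε
  have hU : Ico u v = ⋃ i : Fin n, Ico (c i.castSucc) (c i.succ) := by
    ext x
    simp only [mem_iUnion]
    exact ⟨fun hx => h.cov hx, fun ⟨i, hi⟩ => h.sub i hi⟩
  have hvolI : volume (Ico u v) = ∑ i : Fin n, volume (Ico (c i.castSucc) (c i.succ)) := by
    rw [hU, measure_iUnion _ (fun i => measurableSet_Ico), tsum_fintype]
    intro i j hij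
    rw [Function.onFun, Set.disjoint_left]
    intro x hi hj
    exact hij (h.disj i j x hi hj)
  have hvol2 : volume (⋃ i : Fin n, Ico (c i.castSucc + τ i) (c i.succ + τ i)) =
      ∑ i : Fin n, volume (Ico (c i.castSucc) (c i.succ)) := by
    rw [measure_iUnion _ (fun i => measurableSet_Ico), tsum_fintype]
    · apply Finset.sum_congr rfl
      intro i _
      simp only [Real.volume_Ico]
      congr 1; ring
    · intro i j hij
      rw [Function.onFun, Set.disjoint_left]
      intro z hi hj
      rw [← himg] at hi hj
      obtain ⟨x, hx, rfl⟩ := hi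
      obtain ⟨x', hx', hxx⟩ := hj
      have := h.inj (h.sub j hx') (h.sub i hx) hxx
      subst this
      exact hij (h.disj i j _ hx hx')
  have hsub : (⋃ i : Fin n, Ico (c i.castSucc + τ i) (c i.succ + τ i)) ∪ Ico y b ⊆ Ico u v := by
    intro z hz
    rcases hz with hz | hz
    · obtain ⟨i, hi⟩ := mem_iUnion.mp hz
      rw [← himg] at hi
      obtain ⟨x, hx, rfl⟩ := hi
      exact h.maps (h.sub i hx)
    · exact ⟨by linarith [hz.1, hy.1], by linarith [hz.2]⟩
  have hle := measure_mono (μ := volume) hsub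
  rw [measure_union _ measurableSet_Ico, hvol2, ← hvolI, Real.volume_Ico, Real.volume_Ico,
    ← ENNReal.ofReal_add (by linarith [hy.1, hy.2]) (by linarith)] at hle
  · rw [ENNReal.ofReal_le_ofReal_iff (by linarith [hy.1, hy.2])] at hle
    linarith
  · rw [Set.disjoint_left]
    intro z hz hz'
    obtain ⟨i, hi⟩ := mem_iUnion.mp hz
    exact hb i z hz' hi

end ret

end IET

namespace IET

lemma enum (C : Finset ℝ) (u v : ℝ) (hu : u ∈ C) (hv : v ∈ C)
    (hC : ∀ x ∈ C, u ≤ x ∧ x ≤ v) (n : ℕ) (hn : C.card = n + 1) :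
    ∃ c : Fin (n + 1) → ℝ, StrictMono c ∧ c 0 = u ∧ c (Fin.last n) = v ∧ range c = ↑C := by
  have hr := Finset.range_orderEmbOfFin C hn
  have hm : StrictMono (C.orderEmbOfFin hn) := (C.orderEmbOfFin hn).strictMono
  refine ⟨C.orderEmbOfFin hn, hm, ?_, ?_, hr⟩
  · obtain ⟨i, hi⟩ : u ∈ range (C.orderEmbOfFin hn) := by rw [hr]; exact hu
    apply le_antisymm
    · calc _ ≤ (C.orderEmbOfFin hn) i := hm.monotone (Fin.zero_le _)
        _ = u := hi
    · exact (hC _ (Finset.orderEmbOfFin_mem C hn _)).1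
  · obtain ⟨i, hi⟩ : v ∈ range (C.orderEmbOfFin hn) := by rw [hr]; exact hv
    apply le_antisymm
    · exact (hC _ (Finset.orderEmbOfFin_mem C hn _)).2
    · calc v = (C.orderEmbOfFin hn) i := hi.symm
        _ ≤ _ := hm.monotone (Fin.le_last _)

lemma frontier_fin {ι : Type} [Finite ι] (A : ι → Set ℝ) (h : ∀ i, (frontier (A i)).Finite) :
    (frontier (⋃ i, A i)).Finite := by
  apply Set.Finite.subset (Set.finite_iUnion h)
  intro x hx
  rw [frontier_eq_closure_inter_closure, closure_iUnion_of_finite] at hx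
  obtain ⟨i, hi⟩ := mem_iUnion.mp hx.1
  refine mem_iUnion.mpr ⟨i, ?_⟩
  rw [frontier_eq_closure_inter_closure]
  exact ⟨hi, closure_mono (compl_subset_compl.mpr (subset_iUnion A i)) hx.2⟩

section keane
variable {s : ℕ} (X : IET s)

lemma first_hit (p : ℕ → Prop) (k : ℕ) (hk : p k) (h : ∀ j < k, ¬ p j) : sInf {n | p n} = k := by
  apply le_antisymm (Nat.sInf_le hk)
  by_contra hlt
  push Not at hlt
  exact h _ hlt (Nat.sInf_mem (s := {n | p n}) ⟨k, hk⟩)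

lemma retPart_general (u v : ℝ) (hlu : X.l ≤ u) (huv : u < v) (hvr : v ≤ X.r) :
    ∃ (n : ℕ) (c : Fin (n + 1) → ℝ) (m : Fin n → ℕ), X.RetPart u v c m := by
  classical
  let ρ : ℝ → ℕ := fun w => sInf {n : ℕ | X.P (-(n : ℤ)) w ∈ Ioo u v}
  let W : Finset ℝ := insert u (insert v (Finset.univ.image X.sep))
  let C : Finset ℝ := insert u (insert v
    ((W.image (fun w => X.P (-(ρ w : ℤ)) w)).filter (fun x => x ∈ Ioo u v)))
  have hCcard : 0 < C.card := Finset.card_pos.mpr ⟨u, by simp [C]⟩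
  obtain ⟨c, hc, h0, h1, hr⟩ := enum C u v (by simp [C]) (by simp [C]) (by
    intro x hx
    simp only [C, Finset.mem_insert, Finset.mem_filter] at hx
    rcases hx with rfl | rfl | hx
    · exact ⟨le_rfl, huv.le⟩
    · exact ⟨huv.le, le_rfl⟩
    · exact ⟨hx.2.1.le, hx.2.2.le⟩) (C.card - 1) (by omega)
  obtain ⟨m, hm⟩ := X.retPart_exists u v hlu huv hvr c hc h0 h1 (by
    intro w hw k hk hj
    have hρ : ρ w = k := first_hit (fun n : ℕ => X.P (-(n : ℤ)) w ∈ Ioo u v) k hk hj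
    have hW : w ∈ W := by
      simp only [W, Finset.mem_insert, Finset.mem_image, Finset.mem_univ, true_and]
      rcases hw with ⟨i, _, rfl⟩ | ⟨rfl, _⟩ | ⟨rfl, _⟩
      · exact Or.inr (Or.inr ⟨i, rfl⟩)
      · exact Or.inl rfl
      · exact Or.inr (Or.inl rfl)
    rw [hr]
    simp only [C, Finset.coe_insert, Set.mem_insert_iff, Finset.mem_coe, Finset.mem_filter,
      Finset.mem_image]
    exact Or.inr (Or.inr ⟨⟨w, hW, by rw [hρ]⟩, hk⟩))
  exact ⟨_, c, m, hm⟩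

/-- boundary points of an invariant set propagate away from separation points -/
lemma frontier_step (U : Set ℝ) (hU : ∀ z ∈ Ico X.l X.r, (z ∈ U ↔ X.P 1 z ∈ U)) (y : ℝ)
    (hy : y ∈ Ico X.l X.r) (hns : ∀ i, y ≠ X.sep i) :
    (y ∈ frontier U ∩ Ioo X.l X.r ↔ X.P 1 y ∈ frontier U ∩ Ioo X.l X.r) := by
  obtain ⟨i, hi⟩ := X.pieceX y hy
  have hlt : X.sep i < y := lt_of_le_of_ne hi.1 (Ne.symm (hns i))
  have e := X.P_one_piece i y hi
  have e0 := X.P_one_piece i (X.sep i) ⟨le_rfl, X.sep_lt_succ i⟩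
  have h1 : y ∈ Ioo X.l X.r := ⟨lt_of_le_of_lt (X.sep_mem i).1 hlt, hy.2⟩
  have h2 : X.P 1 y ∈ Ioo X.l X.r := by
    refine ⟨?_, (X.P_mem 1 y hy).2⟩
    have := (X.P_mem 1 _ (X.sep_mem i)).1
    linarith
  have hopen : Ioo (X.sep i) (X.γ i.succ) ∈ nhds y := Ioo_mem_nhds hlt hi.2
  have hloc : (y ∈ frontier U ↔ X.P 1 y ∈ frontier U) := by
    let φ : ℝ ≃ₜ ℝ := Homeomorph.addRight (X.α i)
    have hφ : ∀ x, φ x = x + X.α i := fun x => rfl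
    have hfr : X.P 1 y ∈ frontier U ↔ y ∈ frontier (φ ⁻¹' U) := by
      rw [← φ.preimage_frontier, Set.mem_preimage, hφ, e]
    rw [hfr]
    have hev : ∀ x ∈ Ioo (X.sep i) (X.γ i.succ), (x ∈ U ↔ x ∈ φ ⁻¹' U) := by
      intro x hx
      rw [Set.mem_preimage, hφ, ← X.P_one_piece i x ⟨hx.1.le, hx.2⟩]
      exact hU x ⟨le_trans (X.sep_mem i).1 hx.1.le, lt_of_lt_of_le hx.2 (X.γ_le _).2⟩
    have hI : Ioo (X.sep i) (X.γ i.succ) ∩ U = Ioo (X.sep i) (X.γ i.succ) ∩ φ ⁻¹' U := by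
      ext x
      exact ⟨fun h => ⟨h.1, (hev x h.1).mp h.2⟩, fun h => ⟨h.1, (hev x h.1).mpr h.2⟩⟩
    have f1 := frontier_inter_open_inter (s := U) (isOpen_Ioo (a := X.sep i) (b := X.γ i.succ))
    have f2 := frontier_inter_open_inter (s := φ ⁻¹' U)
      (isOpen_Ioo (a := X.sep i) (b := X.γ i.succ))
    rw [Set.inter_comm U, hI, Set.inter_comm, ← Set.inter_comm (φ ⁻¹' U), Set.inter_comm] at f1
    have hyO : y ∈ Ioo (X.sep i) (X.γ i.succ) := ⟨hlt, hi.2⟩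
    have f3 := f1.symm.trans f2
    have : y ∈ frontier U ∩ Ioo (X.sep i) (X.γ i.succ) ↔
        y ∈ frontier (φ ⁻¹' U) ∩ Ioo (X.sep i) (X.γ i.succ) := by rw [f3]
    simpa [hyO.1, hyO.2] using this
  exact ⟨fun h => ⟨hloc.mp h.1, h2⟩, fun h => ⟨hloc.mpr h.1, h1⟩⟩

lemma keane (hreg : X.Regular) (hs : 2 ≤ s) (u v : ℝ) (hlu : X.l ≤ u) (huv : u < v)
    (hvr : v ≤ X.r) (z : ℝ) (hz : z ∈ Ico X.l X.r) :
    (∃ k : ℕ, X.P (-(k : ℤ)) z ∈ Ico u v) ∧ ∃ k : ℕ, 0 < k ∧ X.P k z ∈ Ico u v := by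
  obtain ⟨n, c, m, h⟩ := X.retPart_general u v hlu huv hvr
  let U : Set ℝ := ⋃ i : Fin n, ⋃ k : Fin (m i), X.P (k : ℕ) '' Ico (c i.castSucc) (c i.succ)
  have memU : ∀ z, z ∈ U ↔ ∃ i : Fin n, ∃ k : ℕ, k < m i ∧
      ∃ x ∈ Ico (c i.castSucc) (c i.succ), X.P k x = z := by
    intro z
    simp only [U, mem_iUnion, Set.mem_image]
    constructor
    · rintro ⟨i, k, x, hx, hxz⟩
      exact ⟨i, k, k.2, x, hx, hxz⟩
    · rintro ⟨i, k, hk, x, hx, hxz⟩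
      exact ⟨i, ⟨k, hk⟩, x, hx, hxz⟩
  have hIU : Ico u v ⊆ U := by
    intro x hx
    obtain ⟨i, hi⟩ := h.cov hx
    exact (memU x).mpr ⟨i, 0, (h.2.2.2.2.2.2 i).1, x, hi, by simp [P_zero]⟩
  have hinv : ∀ z ∈ Ico X.l X.r, (z ∈ U ↔ X.P 1 z ∈ U) := by
    intro z hz
    constructor
    · intro hzU
      obtain ⟨i, k, hk, x, hx, rfl⟩ := (memU z).mp hzU
      rw [← P_add]
      have e : (1 : ℤ) + k = ((k + 1 : ℕ) : ℤ) := by push_cast; ring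
      rw [e]
      rcases Nat.lt_or_ge (k + 1) (m i) with h1 | h1
      · exact (memU _).mpr ⟨i, k + 1, h1, x, hx, rfl⟩
      · have : k + 1 = m i := by omega
        rw [this]
        exact hIU ((h.2.2.2.2.2.2 i).2.2.2 x hx)
    · intro hzU
      obtain ⟨i, k, hk, x, hx, hxz⟩ := (memU _).mp hzU
      have main : ∀ i : Fin n, ∀ k : ℕ, 0 < k → k ≤ m i → ∀ x ∈ Ico (c i.castSucc) (c i.succ),
          X.P k x = X.P 1 z → z ∈ U := by
        intro i k hk0 hk x hx hxz
        refine (memU z).mpr ⟨i, k - 1, by omega, x, hx, ?_⟩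
        apply X.P_inj 1
        rw [← hxz, ← P_add]
        congr 1
        push_cast [Nat.cast_sub (show 1 ≤ k from hk0)]; ring
      rcases Nat.eq_zero_or_pos k with rfl | hk0
      · simp only [Nat.cast_zero, P_zero] at hxz
        obtain ⟨x', hx', hxx⟩ := h.surj (h.sub i hx)
        obtain ⟨i', hi'⟩ := h.cov hx'
        rw [h.fr i' hi', hxz] at hxx
        exact main i' (m i') (h.2.2.2.2.2.2 i').1 le_rfl x' hi' hxx
      · exact main i k hk0 hk.le x hx hxz
  have hfin : (frontier U).Finite := by
    apply frontier_fin
    intro i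
    apply frontier_fin
    intro k
    obtain ⟨τ, hτ⟩ := (h.2.2.2.2.2.2 i).2.1 k k.2.le
    have e : X.P (k : ℕ) '' Ico (c i.castSucc) (c i.succ) =
        Ico (c i.castSucc + τ) (c i.succ + τ) := by
      rw [← image_add_const_Ico]
      exact image_congr hτ
    rw [e, frontier_Ico (by linarith [h.2.2.2.1 (Fin.castSucc_lt_succ (i := i))])]
    exact Set.toFinite _
  set B := frontier U ∩ Ioo X.l X.r with hB
  have hBfin : B.Finite := hfin.subset inter_subset_left
  have hinfin : ∀ x ∈ Ico X.l X.r, ∀ ε : ℤ, ε ≠ 0 → (∀ k : ℕ, X.P (ε * k) x ∈ B) → False := by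
    intro x hx ε hε hall
    obtain ⟨a, _, b, _, hab, heq⟩ := infinite_univ.exists_ne_map_eq_of_mapsTo
      (f := fun k : ℕ => X.P (ε * k) x) (fun k _ => hall k) hBfin
    have key : ∀ p q : ℤ, p < q → X.P p x = X.P q x → False := by
      intro p q hpq he
      refine X.noPer hreg hs x hx (q - p).toNat (by omega) ?_
      apply X.P_inj p
      rw [← P_add, Int.toNat_of_nonneg (by omega), he]
      congr 1; ring
    have hne : ε * (a : ℤ) ≠ ε * b := by
      intro h'
      exact hab (by exact_mod_cast mul_left_cancel₀ hε h')
    rcases lt_or_gt_of_ne hne with h' | h'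
    · exact key _ _ h' heq
    · exact key _ _ h' heq.symm
  have hBempty : ∀ x, x ∉ B := by
    intro x hxB
    have hxA : x ∈ Ico X.l X.r := ⟨hxB.2.1.le, hxB.2.2⟩
    have hfwd : ∃ (a : ℕ) (i : Fin s), X.P a x = X.sep i := by
      by_contra hcon
      push Not at hcon
      apply hinfin x hxA 1 (by norm_num)
      intro k
      rw [one_mul]
      induction k with
      | zero => simpa [P_zero] using hxB
      | succ k ih =>
        have e : ((k + 1 : ℕ) : ℤ) = 1 + k := by push_cast; ring
        rw [e, P_add]
        exact (X.frontier_step U hinv _ (X.P_mem _ _ hxA) (hcon k)).mp ih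
    have hbwd : ∃ (a : ℕ) (i : Fin s), 0 < a ∧ X.P (-(a : ℤ)) x = X.sep i := by
      by_contra hcon
      push Not at hcon
      apply hinfin x hxA (-1) (by norm_num)
      intro k
      rw [neg_one_mul]
      induction k with
      | zero => simpa [P_zero] using hxB
      | succ k ih =>
        refine (X.frontier_step U hinv _ (X.P_mem _ _ hxA)
          (fun i => hcon (k + 1) i (by omega))).mpr ?_
        rw [← P_add]
        have e : 1 + -((k + 1 : ℕ) : ℤ) = -k := by push_cast; ring
        rw [e]; exact ih
    obtain ⟨a, i, hai⟩ := hfwd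
    obtain ⟨b, j, hb0, hbj⟩ := hbwd
    have hconn : X.P (a + b) (X.sep j) = X.sep i := by
      rw [← hbj, ← P_add, ← hai]; congr 1; ring
    obtain ⟨i', hi', hi⟩ := X.sep_orb hreg hs i
    obtain ⟨j', hj', hj⟩ := X.sep_orb hreg hs j
    rcases hj with ⟨_, ej⟩ | ⟨_, ej⟩ <;> rcases hi with ⟨_, ei⟩ | ⟨hi0, ei⟩ <;>
      rw [ej, ei, ← P_add] at hconn <;>
      have hh := (X.reg' hreg j' i' hj' hi' _ _ hconn).2
    · omega
    · have ha : a = 0 := by omega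
      subst ha
      simp only [Nat.cast_zero, P_zero] at hai
      have := hxB.2.1
      rw [hai, X.sep_zero i hi0] at this
      exact lt_irrefl _ this
    · omega
    · omega
  have hIoo : Ioo X.l X.r ⊆ U := by
    intro x hx
    by_contra hxU
    have hcov : Ioo X.l X.r ⊆ interior U ∪ interior Uᶜ := by
      intro y hy
      rw [← compl_frontier_eq_union_interior]
      exact fun hyf => hBempty y ⟨hyf, hy⟩
    have hmid : (u + v) / 2 ∈ Ioo X.l X.r := ⟨by linarith, by linarith⟩
    have hmidU : (u + v) / 2 ∈ U := hIU ⟨by linarith, by linarith⟩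
    have hm1 : (u + v) / 2 ∈ interior U := by
      rcases hcov hmid with h' | h'
      · exact h'
      · exact absurd hmidU (interior_subset h')
    have hx1 : x ∈ interior Uᶜ := by
      rcases hcov hx with h' | h'
      · exact absurd (interior_subset h') hxU
      · exact h'
    obtain ⟨y, _, hy1, hy2⟩ := isPreconnected_Ioo (interior U) (interior Uᶜ) isOpen_interior
      isOpen_interior hcov ⟨_, hmid, hm1⟩ ⟨_, hx, hx1⟩
    exact interior_subset hy2 (interior_subset hy1)
  have hzU : z ∈ U := by
    rcases eq_or_lt_of_le hz.1 with h0 | h0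
    · obtain ⟨j, hj, hjl⟩ := X.pre_l hreg hs
      rw [← h0, ← hjl]
      exact (hinv _ (X.sep_mem j)).mp (hIoo ⟨X.sep_pos j hj, (X.sep_mem j).2⟩)
    · exact hIoo ⟨h0, hz.2⟩
  obtain ⟨i, k, hk, x, hx, rfl⟩ := (memU z).mp hzU
  refine ⟨⟨k, ?_⟩, ⟨m i - k, by omega, ?_⟩⟩
  · rw [P_neg_cancel]; exact h.sub i hx
  · rw [← P_add]
    have e : ((m i - k : ℕ) : ℤ) + k = m i := by push_cast [Nat.cast_sub hk.le]; ring
    rw [e]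
    exact (h.2.2.2.2.2.2 i).2.2.2 x hx

end keane

end IET

namespace IET

section mainsec
variable {s : ℕ} (X : IET s)

lemma keaneIoo (hreg : X.Regular) (hs : 2 ≤ s) (u v : ℝ) (hlu : X.l ≤ u) (huv : u < v)
    (hvr : v ≤ X.r) (z : ℝ) (hz : z ∈ Ico X.l X.r) :
    (∃ k : ℕ, X.P (-(k : ℤ)) z ∈ Ioo u v) ∧ ∃ k : ℕ, 0 < k ∧ X.P k z ∈ Ioo u v := by
  obtain ⟨⟨k, hk⟩, ⟨k', hk0, hk'⟩⟩ :=
    X.keane hreg hs ((u + v) / 2) v (by linarith) (by linarith) hvr z hz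
  exact ⟨⟨k, by linarith [hk.1], hk.2⟩, ⟨k', hk0, by linarith [hk'.1], hk'.2⟩⟩

lemma rhoM_eq (u v z : ℝ) (hz : z ∈ Ico X.l X.r) :
    X.rhoM u v z = sInf {n : ℕ | X.P (-(n : ℤ)) z ∈ Ioo u v} := by
  unfold rhoM
  simp only [X.iter_eq _ z hz]

lemma rhoP_eq (u v z : ℝ) (hz : z ∈ Ico X.l X.r) :
    X.rhoP u v z = sInf {n : ℕ | 0 < n ∧ X.P n z ∈ Ioo u v} := by
  unfold rhoP
  simp only [X.iter_eq _ z hz]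

lemma mem_Div (u v y : ℝ) : y ∈ X.Div u v ↔ ∃ (i : Fin s) (k : ℤ),
    -(X.rhoM u v (X.sep i) : ℤ) ≤ k ∧ k < (X.rhoP u v (X.sep i) : ℤ) ∧ X.P k (X.sep i) = y := by
  unfold Div nbrs
  simp only [mem_iUnion, Set.mem_ofPred_eq, X.iter_eq _ _ (X.sep_mem _)]

lemma two_le (u v : ℝ) (hadm : X.Admissible u v) : 2 ≤ s := by
  obtain ⟨hlu, huv, hvr, hu, _⟩ := hadm
  have hs0 := X.s_pos
  by_contra hlt
  have hs1 : s = 1 := by omega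
  subst hs1
  obtain ⟨i, k, h1, h2, _⟩ := (X.mem_Div u v u).mp hu
  have hi : i = 0 := Subsingleton.elim _ _
  subst hi
  have hsep : X.sep 0 = X.l := X.sep_zero 0 rfl
  have hl : X.l ∈ Ico X.l X.r := ⟨le_rfl, X.hlr⟩
  -- l is fixed
  obtain ⟨k', x, hx, hxl⟩ := X.exists_pre X.l hl
  have hk' : k' = 0 := Subsingleton.elim _ _
  subst hk'
  have e1 := X.P_one_piece 0 x hx
  have e2 := X.P_one_piece 0 X.l ⟨hsep.le, by rw [← hsep]; exact X.sep_lt_succ 0⟩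
  have e3 := (X.P_mem 1 X.l hl).1
  have hx1 := hx.1
  rw [hsep] at hx1
  have hfix : X.P 1 X.l = X.l := by linarith
  have hall : ∀ n : ℕ, X.P n X.l = X.l := by
    intro n
    induction n with
    | zero => simp [P_zero]
    | succ n ih =>
      have : ((n + 1 : ℕ) : ℤ) = 1 + n := by push_cast; ring
      rw [this, P_add, ih, hfix]
  have hallm : ∀ n : ℕ, X.P (-(n : ℤ)) X.l = X.l := by
    intro n
    conv_lhs => rw [← hall n]
    rw [P_neg_cancel]
  have hnot : X.l ∉ Ioo u v := fun h => absurd h.1 (not_lt.mpr hlu)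
  rw [hsep, X.rhoM_eq _ _ _ hl] at h1
  rw [hsep, X.rhoP_eq _ _ _ hl] at h2
  simp only [hall, hallm, hnot, and_false, Set.ofPred_false, Nat.sInf_empty] at h1 h2
  simp at h1 h2
  omega

/-- positive iterates of an induced map are positive iterates of the map -/
lemma induced_iter (S : IET s) (u v : ℝ)
    (hl : S.l = u) (hr : S.r = v)
    (hT : ∀ z ∈ Ico u v, ∃ a : ℕ, 0 < a ∧ S.T z = X.P a z) (n : ℕ) (z : ℝ) (hz : z ∈ Ico u v) :
    ∃ a : ℕ, n ≤ a ∧ S.P n z = X.P a z := by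
  induction n with
  | zero => exact ⟨0, le_rfl, by simp [P_zero]⟩
  | succ n ih =>
    obtain ⟨a, ha, he⟩ := ih
    have hzS : z ∈ Ico S.l S.r := by rw [hl, hr]; exact hz
    have hmem := S.P_mem n z hzS
    have hmem' := hmem
    rw [hl, hr] at hmem'
    obtain ⟨b, hb, hbe⟩ := hT _ hmem'
    refine ⟨b + a, by omega, ?_⟩
    have : ((n + 1 : ℕ) : ℤ) = 1 + n := by push_cast; ring
    rw [this, P_add, P_one _ _ hmem, hbe, he, ← P_add]
    push_cast
    rfl

theorem induced_main (hreg : X.Regular) (u v : ℝ) (hadm : X.Admissible u v) :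
    ∃ S : IET s, S.Regular ∧ S.l = u ∧ S.r = v ∧
      (∀ z ∈ Set.Ico u v, S.T z = X.firstReturn (Set.Ico u v) z) ∧
      {y : ℝ | ∃ i : Fin s, S.sep i = y} = X.Div u v ∩ Set.Ico u v := by
  classical
  have hs := X.two_le u v hadm
  obtain ⟨hlu, huv, hvr, hu, hv⟩ := hadm
  have hK := X.keaneIoo hreg hs u v hlu huv hvr
  let ρ : Fin s → ℕ := fun i => X.rhoM u v (X.sep i)
  let f : Fin s → ℝ := fun i => X.P (-(ρ i : ℤ)) (X.sep i)
  have hρ_eq : ∀ i, ρ i = sInf {n : ℕ | X.P (-(n : ℤ)) (X.sep i) ∈ Ioo u v} :=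
    fun i => X.rhoM_eq u v _ (X.sep_mem i)
  have hρ : ∀ i, f i ∈ Ioo u v := by
    intro i
    have := Nat.sInf_mem (s := {n : ℕ | X.P (-(n : ℤ)) (X.sep i) ∈ Ioo u v})
      (hK _ (X.sep_mem i)).1
    rw [← hρ_eq] at this
    exact this
  have hρmin : ∀ i, ∀ j < ρ i, X.P (-(j : ℤ)) (X.sep i) ∉ Ioo u v := by
    intro i j hj
    rw [hρ_eq] at hj
    exact Nat.notMem_of_lt_sInf hj
  have hρfirst : ∀ (i : Fin s) (k : ℕ), X.P (-(k : ℤ)) (X.sep i) ∈ Ioo u v →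
      (∀ j : ℕ, j < k → X.P (-(j : ℤ)) (X.sep i) ∉ Ioo u v) → ρ i = k := by
    intro i k hk hj
    rw [hρ_eq]
    exact first_hit (fun n : ℕ => X.P (-(n : ℤ)) (X.sep i) ∈ Ioo u v) k hk hj
  let σ : Fin s → ℕ := fun i => X.rhoP u v (X.sep i)
  have hσ0 : ∀ i, 0 < σ i := by
    intro i
    have := Nat.sInf_mem (s := {n : ℕ | 0 < n ∧ X.P n (X.sep i) ∈ Ioo u v})
      (hK _ (X.sep_mem i)).2
    rw [← X.rhoP_eq _ _ _ (X.sep_mem i)] at this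
    exact this.1
  have hσmin : ∀ i, ∀ j < σ i, 0 < j → X.P j (X.sep i) ∉ Ioo u v := by
    intro i j hj hj0 hmem
    have hj' : j < X.rhoP u v (X.sep i) := hj
    rw [X.rhoP_eq _ _ _ (X.sep_mem i)] at hj'
    exact Nat.notMem_of_lt_sInf hj' ⟨hj0, hmem⟩
  have hDiv : ∀ y, y ∈ X.Div u v ↔ ∃ (i : Fin s) (k : ℤ), -(ρ i : ℤ) ≤ k ∧ k < (σ i : ℤ) ∧
      X.P k (X.sep i) = y := X.mem_Div u v
  have hfDiv : ∀ i, f i ∈ X.Div u v := by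
    intro i
    refine (hDiv _).mpr ⟨i, -(ρ i : ℤ), le_rfl, ?_, rfl⟩
    have := hσ0 i
    omega
  have hf0 : ∀ i, ∃ j : Fin s, (j : ℕ) ≠ 0 ∧ f i = f j := by
    intro i
    obtain ⟨j, hj, ⟨rfl, _⟩ | ⟨hi0, e⟩⟩ := X.sep_orb hreg hs i
    · exact ⟨i, hj, rfl⟩
    · refine ⟨j, hj, ?_⟩
      have hi1 : 0 < ρ i := by
        rcases Nat.eq_zero_or_pos (ρ i) with h0 | h0
        · exfalso
          have := hρ i
          simp only [f, h0, Nat.cast_zero, neg_zero, P_zero] at this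
          rw [X.sep_zero i hi0] at this
          linarith [this.1]
        · exact h0
      have hstep : ∀ t : ℕ, X.P (-((t + 1 : ℕ) : ℤ)) (X.sep i) = X.P (-(t : ℤ)) (X.sep j) := by
        intro t
        rw [e, ← P_add]; congr 1; push_cast; ring
      have hfi : f i = X.P (-((ρ i - 1 : ℕ) : ℤ)) (X.sep j) := by
        rw [← hstep, Nat.sub_add_cancel hi1]
      have : ρ j = ρ i - 1 := by
        apply hρfirst
        · rw [← hfi]; exact hρ i
        · intro t ht
          rw [← hstep]
          exact hρmin i (t + 1) (by omega)
      rw [hfi, ← this]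
  have hDivIoo : ∀ y, y ∈ X.Div u v → y ∈ Ioo u v → ∃ j : Fin s, (j : ℕ) ≠ 0 ∧ y = f j := by
    intro y hy hyI
    obtain ⟨i, k, h1, h2, rfl⟩ := (hDiv y).mp hy
    have hk : k = -(ρ i : ℤ) := by
      by_contra hne
      rcases lt_or_ge 0 k with h0 | h0
      · obtain ⟨k, rfl⟩ := Int.eq_ofNat_of_zero_le h0.le
        exact hσmin i k (by omega) (by omega) hyI
      · obtain ⟨k', hk'⟩ := Int.eq_ofNat_of_zero_le (neg_nonneg.mpr h0)
        have : k = -(k' : ℤ) := by omega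
        subst this
        exact hρmin i k' (by omega) hyI
    subst hk
    exact hf0 i
  have hfinj : ∀ i j : Fin s, (i : ℕ) ≠ 0 → (j : ℕ) ≠ 0 → f i = f j → i = j :=
    fun i j hi hj hij => (X.reg' hreg i j hi hj _ _ hij).1
  let i0 : Fin s := ⟨0, by omega⟩
  have hi0 : ∀ i : Fin s, i ≠ i0 ↔ (i : ℕ) ≠ 0 := by
    intro i; simp [i0, Fin.ext_iff]
  let D : Finset ℝ := insert u ((Finset.univ.erase i0).image f)
  have memD : ∀ y, y ∈ D ↔ y = u ∨ ∃ i : Fin s, (i : ℕ) ≠ 0 ∧ f i = y := by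
    intro y
    simp [D, hi0]
  have hDcard : D.card = s := by
    rw [Finset.card_insert_of_notMem, Finset.card_image_of_injOn, Finset.card_erase_of_mem]
    · simp; omega
    · simp
    · intro i hi j hj hij
      simp only [Finset.coe_erase, Finset.coe_univ, Set.mem_sdiff, Set.mem_univ, true_and,
        Set.mem_singleton_iff] at hi hj
      exact hfinj i j ((hi0 i).mp hi) ((hi0 j).mp hj) hij
    · intro hmem
      obtain ⟨i, _, hi⟩ := Finset.mem_image.mp hmem
      have := (hρ i).1
      rw [hi] at this
      exact lt_irrefl _ this
  have hDI : ∀ y ∈ D, y ∈ Ico u v := by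
    intro y hy
    rcases (memD y).mp hy with rfl | ⟨i, _, rfl⟩
    · exact ⟨le_rfl, huv⟩
    · exact ⟨(hρ i).1.le, (hρ i).2⟩
  have hDDiv : ∀ y, y ∈ D ↔ y ∈ X.Div u v ∩ Ico u v := by
    intro y
    constructor
    · intro hy
      refine ⟨?_, hDI y hy⟩
      rcases (memD y).mp hy with rfl | ⟨i, _, rfl⟩
      · exact hu
      · exact hfDiv i
    · rintro ⟨h1, h2⟩
      rw [memD]
      rcases eq_or_lt_of_le h2.1 with h0 | h0
      · exact Or.inl h0.symm
      · obtain ⟨j, hj, e⟩ := hDivIoo y h1 ⟨h0, h2.2⟩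
        exact Or.inr ⟨j, hj, e.symm⟩
  have hvD : v ∉ D := fun h => lt_irrefl _ (hDI v h).2
  obtain ⟨c, hc, hc0, hc1, hcr⟩ := enum (insert v D) u v (by simp [D]) (by simp) (by
    intro x hx
    rcases Finset.mem_insert.mp hx with rfl | hx
    · exact ⟨huv.le, le_rfl⟩
    · exact ⟨(hDI x hx).1, (hDI x hx).2.le⟩) s (by
    rw [Finset.card_insert_of_notMem hvD, hDcard])
  obtain ⟨m, hm⟩ := X.retPart_exists u v hlu huv hvr c hc hc0 hc1 (by
    intro w hw k hk hj
    have hDivcase : w ∈ X.Div u v → X.P (-(k : ℤ)) w ∈ range c := by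
      intro hwD
      rw [hcr]
      simp only [Finset.coe_insert, Set.mem_insert_iff, Finset.mem_coe]
      right
      rw [hDDiv]
      refine ⟨?_, hk.1.le, hk.2⟩
      obtain ⟨i, k', h1, h2, rfl⟩ := (hDiv w).mp hwD
      rcases le_or_gt (-(ρ i : ℤ)) (k' - k) with h3 | h3
      · refine (hDiv _).mpr ⟨i, k' - k, h3, by omega, ?_⟩
        rw [← P_add]; congr 1; ring
      · exfalso
        refine hj (k' + ρ i).toNat (by omega) ?_
        rw [Int.toNat_of_nonneg (by omega), ← P_add]
        have : -(k' + (ρ i : ℤ)) + k' = -(ρ i : ℤ) := by ring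
        rw [this]
        exact hρ i
    rcases hw with ⟨i, hi, rfl⟩ | ⟨rfl, _⟩ | ⟨rfl, hlt⟩
    · have := hρfirst i k hk hj
      rw [← this, hcr]
      simp only [Finset.coe_insert, Set.mem_insert_iff, Finset.mem_coe]
      exact Or.inr ((memD _).mpr (Or.inr ⟨i, hi, rfl⟩))
    · exact hDivcase hu
    · rcases hv with hv | hv
      · exact hDivcase hv
      · exact absurd hv hlt.ne)
  set F := X.firstReturn (Ico u v) with hF
  have htr : ∀ i : Fin s, ∃ τ, ∀ x ∈ Ico (c i.castSucc) (c i.succ), F x = x + τ := by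
    intro i
    obtain ⟨τ, hτ⟩ := (hm.2.2.2.2.2.2 i).2.1 (m i) le_rfl
    exact ⟨τ, fun x hx => by rw [hF, hm.fr i hx, hτ x hx]⟩
  choose τ hτ using htr
  have hcmem : ∀ i : Fin s, c i.castSucc ∈ Ico (c i.castSucc) (c i.succ) :=
    fun i => ⟨le_rfl, hc Fin.castSucc_lt_succ⟩
  let g : Fin s → ℝ := fun i => c i.castSucc + τ i
  have hg : Function.Injective g := by
    intro i j hij
    have e1 := hτ i _ (hcmem i)
    have e2 := hτ j _ (hcmem j)
    have hij' : c i.castSucc + τ i = c j.castSucc + τ j := hij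
    have := hm.inj (hm.sub i (hcmem i)) (hm.sub j (hcmem j)) (by rw [← hF, e1, e2, hij'])
    exact Fin.castSucc_injective _ (hc.injective this)
  have hbij : BijOn F (Ico u v) (Ico u v) := ⟨hm.maps, hm.inj, hm.surj⟩
  let S : IET s :=
    { l := u
      r := v
      hlr := huv
      γ := c
      γ_mono := hc
      γ_first := hc0
      γ_last := hc1
      α := τ
      π := (Tuple.sort g).symm
      T := F
      Tinv := Function.invFunOn F (Ico u v)
      hT := hτ
      hmaps := hm.maps
      hinv_left := fun x hx => hbij.invOn_invFunOn.1 hx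
      hinv_right := fun x hx => hbij.invOn_invFunOn.2 hx
      hinvmaps := fun x hx => Function.invFunOn_mem (hm.surj hx)
      himg_mono := by
        have := (Tuple.monotone_sort g).strictMono_of_injective
          (hg.comp (Tuple.sort g).injective)
        exact this }
  have hST : ∀ z ∈ Ico u v, ∃ a : ℕ, 0 < a ∧ S.T z = X.P a z := by
    intro z hz
    obtain ⟨i, hi⟩ := hm.cov hz
    exact ⟨m i, (hm.2.2.2.2.2.2 i).1, hm.fr i hi⟩
  have hit := X.induced_iter S u v rfl rfl hST
  have hsepD : ∀ i : Fin s, c i.castSucc ∈ D := by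
    intro i
    have h1 : c i.castSucc ∈ (↑(insert v D) : Set ℝ) := by rw [← hcr]; exact ⟨_, rfl⟩
    rcases Finset.mem_insert.mp (Finset.mem_coe.mp h1) with h2 | h2
    · exact absurd h2 (hm.sub i (hcmem i)).2.ne
    · exact h2
  refine ⟨S, ?_, rfl, rfl, fun z _ => rfl, ?_⟩
  · -- regularity
    have hpt : ∀ i : Fin s, (i : ℕ) ≠ 0 → ∃ i' : Fin s, (i' : ℕ) ≠ 0 ∧ f i' = S.sep i := by
      intro i hi
      rcases (memD _).mp (hsepD i) with h1 | h1
      · exfalso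
        have := S.sep_pos i hi
        exact absurd h1 this.ne'
      · exact h1
    have key : ∀ i j : Fin s, (i : ℕ) ≠ 0 → (j : ℕ) ≠ 0 → ∀ a b : ℤ, a ≤ b →
        S.P a (S.sep i) = S.P b (S.sep j) → i = j ∧ a = b := by
      intro i j hi hj a b hab he
      obtain ⟨i', hi', ei⟩ := hpt i hi
      obtain ⟨j', hj', ej⟩ := hpt j hj
      obtain ⟨p, hp, hpe⟩ := hit (b - a).toNat (S.sep j) (S.sep_mem j)
      rw [Int.toNat_of_nonneg (by omega)] at hpe
      have e1 : S.sep i = X.P p (S.sep j) := by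
        rw [← hpe]
        apply S.P_inj a
        rw [he, ← P_add]; congr 1; ring
      have e2 := e1
      rw [← ei, ← ej] at e2
      simp only [f] at e2
      rw [← P_add] at e2
      obtain ⟨h1, h2⟩ := X.reg' hreg i' j' hi' hj' _ _ e2
      subst h1
      refine ⟨?_, by omega⟩
      have : S.sep i = S.sep j := by rw [← ei, ← ej]
      exact Fin.castSucc_injective _ (hc.injective this)
    intro i j hi hj a b he
    rw [S.iter_eq _ _ (S.sep_mem i), S.iter_eq _ _ (S.sep_mem j)] at he
    rcases le_total a b with hab | hab
    · exact key i j hi hj a b hab he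
    · obtain ⟨h1, h2⟩ := key j i hj hi b a hab he.symm
      exact ⟨h1.symm, h2.symm⟩
  · ext y
    rw [← hDDiv]
    constructor
    · rintro ⟨i, rfl⟩
      exact hsepD i
    · intro hy
      obtain ⟨q, hq⟩ : y ∈ range c := by rw [hcr]; simp [hy]
      have hqne : q ≠ Fin.last s := by
        rintro rfl
        rw [hc1] at hq
        exact lt_irrefl _ (hq ▸ (hDI y hy).2)
      obtain ⟨i, rfl⟩ := Fin.exists_castSucc_eq.mpr hqne
      exact ⟨i, hq⟩

end mainsec

end IET

/-- the first return map of a regular `s`-interval exchange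
transformation on an admissible semi-interval `[u,v)` is a regular
`s`-interval exchange transformation whose separation points are exactly
`Div([u,v),T) ∩ [u,v)`. -/
theorem iet_induced_on_admissible_regular {s : ℕ} (X : IET s) (hreg : X.Regular)
    (u v : ℝ) (hadm : X.Admissible u v) :
    ∃ S : IET s, S.Regular ∧ S.l = u ∧ S.r = v ∧
      (∀ z ∈ Set.Ico u v, S.T z = X.firstReturn (Set.Ico u v) z) ∧
      {y : ℝ | ∃ i : Fin s, S.sep i = y} = X.Div u v ∩ Set.Ico u v := by
  exact X.induced_main hreg u v hadm
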